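/- Fusion relation for the twisted transfer matrices: for every real φ, every N ≥ 1, all nonzero complex w₁,…,w_N and every nonzero complex z, T^{(2)}_φ(z|w₁,…,w_N) = T^{(1)}_φ(z|w₁,…,w_N) ∘ T^{(1)}_φ(qz|w₁,…,w_N) + (−1)^{N+1} (∏_{j=1}^N [q w_j/z][q² z/w_j]) · Id as operators on (ℂ³)^{⊗N}. -/

import Mathlib

open Matrix BigOperators Finset

noncomputable section

/-- `[z] = z - z⁻¹`. -/
def br (z : ℂ) : ℂ := z - z⁻¹

/-- R-matrix `R^{(1,2)}(z)` on ℂ²⊗ℂ³; basis `(ε, σ)` with ε ∈ {0=↑,1=↓}, σ ∈ {0=⇑,1=0,2=⇓}. -/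
def R12 (q c z : ℂ) : Matrix (Fin 2 × Fin 3) (Fin 2 × Fin 3) ℂ :=
  Matrix.of fun p p' =>
    if p = (0,0) ∧ p' = (0,0) then br (q^2*z)
    else if p = (0,1) ∧ p' = (0,1) then br (q*z)
    else if p = (0,2) ∧ p' = (0,2) then br z
    else if p = (1,0) ∧ p' = (1,0) then br z
    else if p = (1,1) ∧ p' = (1,1) then br (q*z)
    else if p = (1,2) ∧ p' = (1,2) then br (q^2*z)
    else if p = (0,1) ∧ p' = (1,0) then c
    else if p = (0,2) ∧ p' = (1,1) then c
    else if p = (1,0) ∧ p' = (0,1) then c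
    else if p = (1,1) ∧ p' = (0,2) then c
    else 0

/-- `R^{(1,2)}` acting on the auxiliary ℂ² and the j-th site of `(ℂ³)^{⊗N}`. -/
def R12at (q c z : ℂ) {N : ℕ} (j : Fin N) :
    Matrix (Fin 2 × (Fin N → Fin 3)) (Fin 2 × (Fin N → Fin 3)) ℂ :=
  Matrix.of fun p p' =>
    R12 q c z (p.1, p.2 j) (p'.1, p'.2 j) *
      if ∀ k, k ≠ j → p.2 k = p'.2 k then 1 else 0

/-- Monodromy matrix `𝒯_a(z) = R^{(1,2)}_{a,N}(q⁻¹z/w_N) ⋯ R^{(1,2)}_{a,1}(q⁻¹z/w₁)`. -/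
def monodromy (q c : ℂ) {N : ℕ} (w : Fin N → ℂ) (z : ℂ) :
    Matrix (Fin 2 × (Fin N → Fin 3)) (Fin 2 × (Fin N → Fin 3)) ℂ :=
  (((List.finRange N).reverse).map fun j => R12at q c (q⁻¹ * z / w j) j).prod

/-- The operator 𝒜(z): auxiliary block (↑,↑) of the monodromy matrix. -/
def Aop (q c : ℂ) {N : ℕ} (w : Fin N → ℂ) (z : ℂ) :
    Matrix (Fin N → Fin 3) (Fin N → Fin 3) ℂ :=
  Matrix.of fun σ τ => monodromy q c w z (0, σ) (0, τ)

/-- The operator ℬ(z): auxiliary block (↑,↓) of the monodromy matrix. -/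
def Bop (q c : ℂ) {N : ℕ} (w : Fin N → ℂ) (z : ℂ) :
    Matrix (Fin N → Fin 3) (Fin N → Fin 3) ℂ :=
  Matrix.of fun σ τ => monodromy q c w z (0, σ) (1, τ)

/-- The operator 𝒟(z): auxiliary block (↓,↓) of the monodromy matrix. -/
def Dop (q c : ℂ) {N : ℕ} (w : Fin N → ℂ) (z : ℂ) :
    Matrix (Fin N → Fin 3) (Fin N → Fin 3) ℂ :=
  Matrix.of fun σ τ => monodromy q c w z (1, σ) (1, τ)

/-- Bethe reference state `|∧⟩ = |⇑…⇑⟩`. -/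
def vac (N : ℕ) : (Fin N → Fin 3) → ℂ := fun σ => if σ = fun _ => 0 then 1 else 0

/-- Bethe vector `|Ψ(w₁,…,w_N)⟩ = ℬ(w₁)⋯ℬ(w_N)|∧⟩`. -/
def bethe (q c : ℂ) {N : ℕ} (w : Fin N → ℂ) : (Fin N → Fin 3) → ℂ :=
  (((List.finRange N).map fun j => Bop q c w (w j)).prod).mulVec (vac N)

/-- Nineteen-vertex R-matrix on ℂ³⊗ℂ³ (basis 0=⇑, 1=0, 2=⇓). -/
def R19 (q z : ℂ) : Matrix (Fin 3 × Fin 3) (Fin 3 × Fin 3) ℂ :=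
  Matrix.of fun p p' =>
    if p = (0,0) ∧ p' = (0,0) then br (q*z) * br (q^2*z)
    else if p = (2,2) ∧ p' = (2,2) then br (q*z) * br (q^2*z)
    else if p = (0,2) ∧ p' = (0,2) then br (q⁻¹*z) * br z
    else if p = (2,0) ∧ p' = (2,0) then br (q⁻¹*z) * br z
    else if p = (0,2) ∧ p' = (2,0) then br q * br (q^2)
    else if p = (2,0) ∧ p' = (0,2) then br q * br (q^2)
    else if p = (0,1) ∧ p' = (0,1) then br z * br (q*z)
    else if p = (1,0) ∧ p' = (1,0) then br z * br (q*z)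
    else if p = (1,2) ∧ p' = (1,2) then br z * br (q*z)
    else if p = (2,1) ∧ p' = (2,1) then br z * br (q*z)
    else if p = (0,1) ∧ p' = (1,0) then br (q^2) * br (q*z)
    else if p = (1,0) ∧ p' = (0,1) then br (q^2) * br (q*z)
    else if p = (1,2) ∧ p' = (2,1) then br (q^2) * br (q*z)
    else if p = (2,1) ∧ p' = (1,2) then br (q^2) * br (q*z)
    else if p = (1,1) ∧ p' = (0,2) then br (q^2) * br z
    else if p = (1,1) ∧ p' = (2,0) then br (q^2) * br z
    else if p = (0,2) ∧ p' = (1,1) then br (q^2) * br z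
    else if p = (2,0) ∧ p' = (1,1) then br (q^2) * br z
    else if p = (1,1) ∧ p' = (1,1) then br z * br (q*z) + br q * br (q^2)
    else 0

/-- `R(z)` acting on the auxiliary ℂ³ and the j-th site of `(ℂ³)^{⊗N}`. -/
def R19at (q z : ℂ) {N : ℕ} (j : Fin N) :
    Matrix (Fin 3 × (Fin N → Fin 3)) (Fin 3 × (Fin N → Fin 3)) ℂ :=
  Matrix.of fun p p' =>
    R19 q z (p.1, p.2 j) (p'.1, p'.2 j) *
      if ∀ k, k ≠ j → p.2 k = p'.2 k then 1 else 0

/-- The twist Ω (given by its diagonal `d`) acting on the auxiliary ℂ³. -/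
def omegaAux (d : Fin 3 → ℂ) {N : ℕ} :
    Matrix (Fin 3 × (Fin N → Fin 3)) (Fin 3 × (Fin N → Fin 3)) ℂ :=
  Matrix.of fun p p' => if p = p' then d p.1 else 0

/-- Transfer matrix `T^{(2)}(z|w₁,…,w_N)` of the nineteen-vertex model with twist diagonal `d`:
the partial trace over the auxiliary space of `Ω_a R_{a,N}(z/w_N) ⋯ R_{a,1}(z/w₁)`. -/
def T2 (q : ℂ) (d : Fin 3 → ℂ) {N : ℕ} (w : Fin N → ℂ) (z : ℂ) :
    Matrix (Fin N → Fin 3) (Fin N → Fin 3) ℂ :=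
  Matrix.of fun σ τ =>
    ∑ a : Fin 3,
      ((omegaAux d * (((List.finRange N).reverse).map fun j => R19at q (z / w j) j).prod :
        Matrix (Fin 3 × (Fin N → Fin 3)) (Fin 3 × (Fin N → Fin 3)) ℂ)) (a, σ) (a, τ)

/-- Twisted transfer matrix `T^{(1)}_φ(z) = e^{iφ/2}𝒜(z) + e^{−iφ/2}𝒟(z)`. -/
def T1 (q c : ℂ) (φ : ℝ) {N : ℕ} (w : Fin N → ℂ) (z : ℂ) :
    Matrix (Fin N → Fin 3) (Fin N → Fin 3) ℂ :=
  Complex.exp (Complex.I * (φ/2)) • Aop q c w z +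
    Complex.exp (-(Complex.I * (φ/2))) • Dop q c w z

/-- The operator on `(ℂ³)^{⊗N}` acting as `X` on the `j`-th factor. -/
def siteOp {N : ℕ} (j : Fin N) (X : Matrix (Fin 3) (Fin 3) ℂ) :
    Matrix (Fin N → Fin 3) (Fin N → Fin 3) ℂ :=
  Matrix.of fun σ τ => X (σ j) (τ j) * if ∀ k, k ≠ j → σ k = τ k then 1 else 0

lemma siteOp_apply_eq_sum {N : ℕ} (j : Fin N) (X : Matrix (Fin 3) (Fin 3) ℂ)
    (σ τ : Fin N → Fin 3) :
    siteOp j X σ τ = ∑ r, X (σ j) r * if τ = Function.update σ j r then 1 else 0 := by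
  have key (r : Fin 3) :
      τ = Function.update σ j r ↔ τ j = r ∧ ∀ k, k ≠ j → σ k = τ k := by
    rw [Function.eq_update_iff]
    simp only [eq_comm]
  rw [Finset.sum_eq_single (τ j)]
  · simp [siteOp, key]
  · intro r _ hr
    simp [key, hr.symm]
  · simp

lemma siteOp_mul_apply {N : ℕ} (j : Fin N) (X : Matrix (Fin 3) (Fin 3) ℂ)
    (B : Matrix (Fin N → Fin 3) (Fin N → Fin 3) ℂ) (σ τ : Fin N → Fin 3) :
    (siteOp j X * B) σ τ = ∑ r, X (σ j) r * B (Function.update σ j r) τ := by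
  simp only [Matrix.mul_apply, siteOp_apply_eq_sum, Finset.sum_mul]
  rw [Finset.sum_comm]
  simp

lemma siteOp_mul {N : ℕ} (j : Fin N) (X Y : Matrix (Fin 3) (Fin 3) ℂ) :
    siteOp j (X * Y) = siteOp j X * siteOp j Y := by
  ext σ τ
  rw [siteOp_mul_apply]
  simp only [siteOp_apply_eq_sum, Function.update_self, Function.update_idem, Matrix.mul_apply,
    Finset.sum_mul, Finset.mul_sum, mul_assoc]
  exact Finset.sum_comm

lemma siteOp_commute {N : ℕ} {j k : Fin N} (h : j ≠ k) (X Y : Matrix (Fin 3) (Fin 3) ℂ) :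
    Commute (siteOp j X) (siteOp k Y) := by
  ext σ τ
  rw [siteOp_mul_apply, siteOp_mul_apply]
  simp only [siteOp_apply_eq_sum, Function.update_of_ne h, Function.update_of_ne h.symm,
    Finset.mul_sum]
  rw [Finset.sum_comm]
  simp only [Function.update_comm h, mul_left_comm]

/-- `siteOp j` as an algebra homomorphism. -/
def siteHom {N : ℕ} (j : Fin N) :
    Matrix (Fin 3) (Fin 3) ℂ →ₐ[ℂ] Matrix (Fin N → Fin 3) (Fin N → Fin 3) ℂ :=
  AlgHom.ofLinearMap
    { toFun := siteOp j
      map_add' := fun X Y => by ext σ τ; simp only [siteOp, Matrix.of_apply, Matrix.add_apply]; ring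
      map_smul' := fun a X => by
        ext σ τ
        simp only [siteOp, Matrix.of_apply, Matrix.smul_apply, smul_eq_mul, RingHom.id_apply]
        ring }
    (by
      ext σ τ
      simp only [LinearMap.coe_mk, AddHom.coe_mk, siteOp, Matrix.of_apply, Matrix.one_apply,
        ← ite_and, mul_ite, mul_one, mul_zero]
      refine if_congr ?_ rfl rfl
      rw [funext_iff]
      exact ⟨fun h k => (eq_or_ne k j).elim (fun e => e ▸ h.2) (h.1 k),
        fun h => ⟨fun k _ => h k, h j⟩⟩)
    (siteOp_mul j)

/-- An operator on `A ⊗ ℂ³`, viewed as a matrix over the auxiliary space with entries acting on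
the `j`-th quantum space. -/
def laxAt {A : Type*} {N : ℕ} (j : Fin N) (X : Matrix (A × Fin 3) (A × Fin 3) ℂ) :
    Matrix A A (Matrix (Fin N → Fin 3) (Fin N → Fin 3) ℂ) :=
  ((Matrix.comp A A (Fin 3) (Fin 3) ℂ).symm X).map (siteHom j)

lemma laxAt_prod_commute {A : Type*} [Fintype A] [DecidableEq A] {B : Type*} {N : ℕ}
    (X : Fin N → Matrix (A × Fin 3) (A × Fin 3) ℂ) (Y : Matrix (B × Fin 3) (B × Fin 3) ℂ)
    (j : Fin N) (l : List (Fin N)) (hj : j ∉ l) (a a' : A) (b b' : B) :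
    Commute ((l.map fun k => laxAt k (X k)).prod a a') (laxAt j Y b b') := by
  induction l generalizing a with
  | nil =>
    rw [List.map_nil, List.prod_nil, Matrix.one_apply]
    split_ifs
    · exact Commute.one_left _
    · exact Commute.zero_left _
  | cons k l ih =>
    rw [List.mem_cons, not_or] at hj
    rw [List.map_cons, List.prod_cons, Matrix.mul_apply]
    exact Commute.sum_left _ _ _ fun i _ =>
      (siteOp_commute (Ne.symm hj.1) _ _).mul_left (ih hj.2 i)

lemma kroneckerMap_laxAt_prod {A B : Type*} [Fintype A] [DecidableEq A] [Fintype B] [DecidableEq B]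
    {N : ℕ} (X : Fin N → Matrix (A × Fin 3) (A × Fin 3) ℂ)
    (Y : Fin N → Matrix (B × Fin 3) (B × Fin 3) ℂ) (l : List (Fin N)) (hl : l.Nodup) :
    Matrix.kroneckerMap (· * ·) (l.map fun k => laxAt k (X k)).prod
        (l.map fun k => laxAt k (Y k)).prod =
      (l.map fun k => Matrix.kroneckerMap (· * ·) (laxAt k (X k)) (laxAt k (Y k))).prod := by
  induction l with
  | nil => exact Matrix.one_kronecker_one
  | cons j l ih =>
    rw [List.nodup_cons] at hl
    simp only [List.map_cons, List.prod_cons]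
    rw [← ih hl.2]
    ext1 ⟨a, b⟩ ⟨a', b'⟩
    simp only [Matrix.kroneckerMap_apply, Matrix.mul_apply, Fintype.sum_prod_type,
      Finset.sum_mul_sum]
    refine Finset.sum_congr rfl fun i _ => Finset.sum_congr rfl fun i' _ => ?_
    exact (laxAt_prod_commute X (Y j) j l hl.1 i a' b i').mul_mul_mul_comm _ _

/-- Embedding of the spin-one space into `ℂ² ⊗ ℂ²` as the triplet, with the zero-weight vector
scaled by `g`. -/
def triplet (R : Type*) [Ring R] [Algebra ℂ R] (g : ℂ) : Matrix (Fin 2 × Fin 2) (Fin 3) R :=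
  (Matrix.of fun a i =>
    if a.1.val + a.2.val = i.val then (if i = 1 then g else 1) else 0).map (algebraMap ℂ R)

/-- The singlet covector on `ℂ² ⊗ ℂ²`. -/
def singlet (R : Type*) [Ring R] [Algebra ℂ R] : Matrix (Fin 1) (Fin 2 × Fin 2) R :=
  (Matrix.of fun _ a => if a = (0, 1) then 1 else if a = (1, 0) then -1 else 0).map (algebraMap ℂ R)

lemma triplet_map {R S : Type*} [Ring R] [Algebra ℂ R] [Ring S] [Algebra ℂ S] (g : ℂ)
    (f : R →ₐ[ℂ] S) : (triplet R g).map f = triplet S g := by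
  ext1 a i
  exact f.commutes _

lemma singlet_map {R S : Type*} [Ring R] [Algebra ℂ R] [Ring S] [Algebra ℂ S]
    (f : R →ₐ[ℂ] S) : (singlet R).map f = singlet S := by
  ext1 a i
  exact f.commutes _

lemma Matrix.map_mul_algHom {R S m n o : Type*} [Fintype n] [Ring R] [Algebra ℂ R] [Ring S]
    [Algebra ℂ S] (f : R →ₐ[ℂ] S) (M : Matrix m n R) (L : Matrix n o R) :
    (M * L).map f = M.map f * L.map f :=
  Matrix.map_mul (f := f.toRingHom)

/-- The product of two consecutive `R^{(1,2)}` matrices on a single site. -/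
def fusedLax (q c u : ℂ) : Matrix (Fin 2 × Fin 2) (Fin 2 × Fin 2) (Matrix (Fin 3) (Fin 3) ℂ) :=
  Matrix.kroneckerMap (· * ·) ((Matrix.comp _ _ _ _ ℂ).symm (R12 q c (q⁻¹ * u)))
    ((Matrix.comp _ _ _ _ ℂ).symm (R12 q c u))

set_option maxHeartbeats 2000000 in
lemma fusedLax_mul_triplet {q c g u : ℂ} (hq : q ≠ 0) (hu : u ≠ 0) (hc : c ^ 2 = br q * br (q ^ 2))
    (hg₁ : g * c * (q + q⁻¹) = br (q ^ 2)) (hg₂ : g * br (q ^ 2) = c) :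
    fusedLax q c u * triplet (Matrix (Fin 3) (Fin 3) ℂ) g =
      triplet (Matrix (Fin 3) (Fin 3) ℂ) g * (Matrix.comp _ _ _ _ ℂ).symm (R19 q u) := by
  have h₁ : q ^ 2 * (q⁻¹ * u) = q * u := by field_simp
  have h₂ : q * (q⁻¹ * u) = u := by field_simp
  have h₃ : br (q ^ 2 * u) + br u = (q + q⁻¹) * br (q * u) := by unfold br; field_simp; ring
  have h₄ : br (q * u) + br (q⁻¹ * u) = (q + q⁻¹) * br u := by unfold br; field_simp; ring
  have h₅ : br (q⁻¹ * u) * br (q ^ 2 * u) + br q * br (q ^ 2) = br u * br (q * u) := by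
    unfold br; field_simp; ring
  ext a i s t
  simp only [triplet, fusedLax, Matrix.mul_apply, Matrix.sum_apply, Fintype.sum_prod_type,
    Matrix.map_apply, Matrix.of_apply, Matrix.kroneckerMap_apply,
    Matrix.comp_symm_apply, Matrix.algebraMap_matrix_apply, Fin.sum_univ_two, Fin.sum_univ_three]
  fin_cases a <;> fin_cases i <;> fin_cases s <;> fin_cases t <;>
    simp [R12, R19, h₁, h₂] <;>
    grind

lemma singlet_mul_fusedLax {q c u : ℂ} (hq : q ≠ 0) (hu : u ≠ 0)
    (hc : c ^ 2 = br q * br (q ^ 2)) :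
    singlet (Matrix (Fin 3) (Fin 3) ℂ) * fusedLax q c u =
      (br (q⁻¹ * u) * br (q ^ 2 * u)) • singlet (Matrix (Fin 3) (Fin 3) ℂ) := by
  have h₁ : q ^ 2 * (q⁻¹ * u) = q * u := by field_simp
  have h₂ : q * (q⁻¹ * u) = u := by field_simp
  have h₃ : br (q⁻¹ * u) * br (q ^ 2 * u) + br q * br (q ^ 2) = br u * br (q * u) := by
    unfold br; field_simp; ring
  ext i a s t
  simp only [singlet, fusedLax, Matrix.mul_apply, Matrix.sum_apply, Fintype.sum_prod_type,
    Matrix.map_apply, Matrix.of_apply, Matrix.kroneckerMap_apply, Matrix.smul_apply,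
    Matrix.comp_symm_apply, Matrix.algebraMap_matrix_apply, Fin.sum_univ_two, Fin.sum_univ_three]
  fin_cases i; fin_cases a <;> fin_cases s <;> fin_cases t <;>
    simp [R12, h₁, h₂] <;>
    grind

lemma exists_gauge {q c : ℂ} (hq : q ≠ 0) (hc : c ^ 2 = br q * br (q ^ 2)) :
    ∃ g : ℂ, g ≠ 0 ∧ g * c * (q + q⁻¹) = br (q ^ 2) ∧ g * br (q ^ 2) = c := by
  have h2 : br (q ^ 2) = br q * (q + q⁻¹) := by unfold br; field_simp; ring
  by_cases h0 : c = 0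
  · have h3 : br (q ^ 2) = 0 := by
      rw [h0, zero_pow two_ne_zero, eq_comm, mul_eq_zero] at hc
      rcases hc with h | h
      · rw [h2, h, zero_mul]
      · exact h
    exact ⟨1, one_ne_zero, by simp [h0, h3], by simp [h0, h3]⟩
  · have h3 : br q ≠ 0 := fun h => h0 (by simpa [h] using hc)
    refine ⟨br q / c, div_ne_zero h3 h0, ?_, ?_⟩
    · rw [div_mul_cancel₀ _ h0, h2]
    · rw [div_mul_eq_mul_div, ← hc, sq, mul_div_assoc, div_self h0, mul_one]

lemma list_prod_mul_eq {n m R ι : Type*} [Fintype n] [DecidableEq n] [Fintype m] [DecidableEq m]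
    [Ring R] (K : ι → Matrix n n R) (L : ι → Matrix m m R) (V : Matrix n m R) (l : List ι)
    (h : ∀ j, K j * V = V * L j) : (l.map K).prod * V = V * (l.map L).prod := by
  induction l with
  | nil => simp
  | cons j l ih =>
    rw [List.map_cons, List.map_cons, List.prod_cons, List.prod_cons, Matrix.mul_assoc, ih,
      ← Matrix.mul_assoc, h, Matrix.mul_assoc]

lemma mul_list_prod_eq_smul {n m R ι : Type*} [Fintype n] [DecidableEq n] [Fintype m]
    [Ring R] [Algebra ℂ R] (K : ι → Matrix n n R) (s : ι → ℂ) (v : Matrix m n R) (l : List ι)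
    (h : ∀ j, v * K j = s j • v) : v * (l.map K).prod = (l.map s).prod • v := by
  induction l with
  | nil => simp
  | cons j l ih =>
    rw [List.map_cons, List.map_cons, List.prod_cons, List.prod_cons, ← Matrix.mul_assoc, h,
      Matrix.smul_mul, ih, smul_smul]

lemma diag_of_intertwines {R : Type*} [Ring R] [Algebra ℂ R] {g s : ℂ} (hg : g ≠ 0)
    {P : Matrix (Fin 2 × Fin 2) (Fin 2 × Fin 2) R} {Q : Matrix (Fin 3) (Fin 3) R}
    (hV : P * triplet R g = triplet R g * Q) (hv : singlet R * P = s • singlet R) :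
    P (0, 0) (0, 0) = Q 0 0 ∧ P (1, 1) (1, 1) = Q 2 2 ∧
      P (0, 1) (0, 1) + P (1, 0) (1, 0) = Q 1 1 + s • (1 : R) := by
  have e₀ := congrFun₂ hV (0, 0) 0
  have e₁ := congrFun₂ hV (0, 1) 1
  have e₂ := congrFun₂ hV (1, 1) 2
  have e₃ := congrFun₂ hv 0 (1, 0)
  simp [triplet, singlet, Matrix.mul_apply, Fintype.sum_prod_type, Fin.sum_univ_succ] at e₀ e₁ e₂ e₃
  rw [← add_mul, ← Algebra.commutes, ← Algebra.smul_def, ← Algebra.smul_def] at e₁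
  have e₁' : P (0, 1) (0, 1) + P (0, 1) (1, 0) = Q 1 1 := by
    simpa only [inv_smul_smul₀ hg] using congrArg (g⁻¹ • ·) e₁
  refine ⟨e₀, e₂, ?_⟩
  rw [← e₁', ← neg_eq_iff_eq_neg.2 e₃]
  abel

/-- Fusion relation for the twisted transfer matrices:
`T^{(2)}_φ(z) = T^{(1)}_φ(z) T^{(1)}_φ(qz) + (−1)^{N+1} ∏_j [q w_j/z][q² z/w_j] · Id`. -/
theorem stmt9 (q c : ℂ) (hq : q ≠ 0) (hc : c^2 = br q * br (q^2)) (φ : ℝ)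
    (N : ℕ) (hN : 1 ≤ N) (w : Fin N → ℂ) (hw : ∀ j, w j ≠ 0)
    (z : ℂ) (hz : z ≠ 0) :
    T2 q ![Complex.exp (Complex.I * φ), 1, Complex.exp (-(Complex.I * φ))] w z =
      T1 q c φ w z * T1 q c φ w (q * z) +
        ((-1 : ℂ)^(N+1) * ∏ j, br (q * w j / z) * br (q^2 * z / w j)) •
          (1 : Matrix (Fin N → Fin 3) (Fin N → Fin 3) ℂ) := by
  obtain ⟨g, hg, hg₁, hg₂⟩ := exists_gauge hq hc
  have hu (j : Fin N) : z / w j ≠ 0 := div_ne_zero hz (hw j)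
  set l := (List.finRange N).reverse with hl
  set P := (l.map fun j => laxAt j (R12 q c (q⁻¹ * z / w j))).prod with hP
  set P' := (l.map fun j => laxAt j (R12 q c (q⁻¹ * (q * z) / w j))).prod with hP'
  set Q := (l.map fun j => laxAt j (R19 q (z / w j))).prod with hQ
  have hM : monodromy q c w z = Matrix.compRingEquiv _ _ _ P := by
    rw [hP, map_list_prod, List.map_map]; rfl
  have hM' : monodromy q c w (q * z) = Matrix.compRingEquiv _ _ _ P' := by
    rw [hP', map_list_prod, List.map_map]; rfl
  have hR : (l.map fun j => R19at q (z / w j) j).prod = Matrix.compRingEquiv _ _ _ Q := by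
    rw [hQ, map_list_prod, List.map_map]; rfl
  have hT (x : ℂ) (y : Fin 2 → Fin 2 → Matrix (Fin N → Fin 3) (Fin N → Fin 3) ℂ)
      (hy : monodromy q c w x = Matrix.compRingEquiv _ _ _ (Matrix.of y)) :
      T1 q c φ w x = Complex.exp (Complex.I * (φ/2)) • y 0 0 +
        Complex.exp (-(Complex.I * (φ/2))) • y 1 1 := by
    unfold T1 Aop Dop
    rw [hy]
    rfl
  have hfused (j : Fin N) : Matrix.kroneckerMap (· * ·) (laxAt j (R12 q c (q⁻¹ * z / w j)))
      (laxAt j (R12 q c (q⁻¹ * (q * z) / w j))) = (fusedLax q c (z / w j)).map (siteHom j) := by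
    rw [inv_mul_cancel_left₀ hq, mul_div_assoc]
    ext1 a b
    exact (map_mul (siteHom j) _ _).symm
  have hK : Matrix.kroneckerMap (· * ·) P P' =
      (l.map fun j => (fusedLax q c (z / w j)).map (siteHom j)).prod := by
    rw [hP, hP', kroneckerMap_laxAt_prod _ _ _ (List.nodup_reverse.2 (List.nodup_finRange N))]
    simp only [hfused, hl]
  have hV : Matrix.kroneckerMap (· * ·) P P' * triplet (Matrix (Fin N → Fin 3) (Fin N → Fin 3) ℂ) g =
      triplet (Matrix (Fin N → Fin 3) (Fin N → Fin 3) ℂ) g * Q := by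
    rw [hK]
    refine list_prod_mul_eq _ _ _ _ fun j => ?_
    have := congrArg (fun M => M.map (siteHom j))
      (fusedLax_mul_triplet hq (hu j) hc hg₁ hg₂)
    rw [Matrix.map_mul_algHom, Matrix.map_mul_algHom, triplet_map] at this
    exact this
  have hv : singlet (Matrix (Fin N → Fin 3) (Fin N → Fin 3) ℂ) * Matrix.kroneckerMap (· * ·) P P' =
      (l.map fun j => br (q⁻¹ * (z / w j)) * br (q ^ 2 * (z / w j))).prod •
        singlet (Matrix (Fin N → Fin 3) (Fin N → Fin 3) ℂ) := by
    rw [hK]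
    refine mul_list_prod_eq_smul _ _ _ _ fun j => ?_
    have := congrArg (fun M => M.map (siteHom j)) (singlet_mul_fusedLax hq (hu j) hc)
    rw [Matrix.map_mul_algHom, Matrix.map_smul _ _ (map_smul _ _), singlet_map] at this
    exact this
  have hs : (l.map fun j => br (q⁻¹ * (z / w j)) * br (q ^ 2 * (z / w j))).prod =
      (-1) ^ N * ∏ j, br (q * w j / z) * br (q ^ 2 * z / w j) := by
    have hperm : l.Perm (List.finRange N) := List.reverse_perm _
    rw [(hperm.map _).prod_eq, ← List.ofFn_eq_map, List.prod_ofFn]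
    have h (j : Fin N) : br (q⁻¹ * (z / w j)) * br (q ^ 2 * (z / w j)) =
        -1 * (br (q * w j / z) * br (q ^ 2 * z / w j)) := by
      have := hw j
      unfold br
      field_simp
      ring
    simp only [h]
    rw [Finset.prod_mul_distrib, Finset.prod_const, Finset.card_univ, Fintype.card_fin]
  obtain ⟨h₀, h₂, h₁⟩ := diag_of_intertwines hg hV hv
  have hT2 : T2 q ![Complex.exp (Complex.I * φ), 1, Complex.exp (-(Complex.I * φ))] w z =
      Complex.exp (Complex.I * φ) • Q 0 0 + Q 1 1 + Complex.exp (-(Complex.I * φ)) • Q 2 2 := by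
    have hΩ (d : Fin 3 → ℂ) : omegaAux d (N := N) = Matrix.diagonal fun p => d p.1 := rfl
    ext σ τ
    rw [hl] at hR
    simp only [T2, hΩ, hR, Matrix.of_apply, Matrix.diagonal_mul, Fin.sum_univ_three]
    simp [Matrix.compRingEquiv]
  have hexp : Complex.exp (Complex.I * (φ/2)) * Complex.exp (Complex.I * (φ/2)) =
      Complex.exp (Complex.I * φ) := by rw [← Complex.exp_add]; ring_nf
  have hexp' : Complex.exp (-(Complex.I * (φ/2))) * Complex.exp (-(Complex.I * (φ/2))) =
      Complex.exp (-(Complex.I * φ)) := by rw [← Complex.exp_add]; ring_nf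
  have hexp₀ : Complex.exp (Complex.I * (φ/2)) * Complex.exp (-(Complex.I * (φ/2))) = 1 := by
    rw [← Complex.exp_add, add_neg_cancel, Complex.exp_zero]
  rw [hT2, hT z P hM, hT (q * z) P' hM', ← h₀, ← h₂, eq_sub_of_add_eq h₁.symm, hs]
  simp only [Matrix.kroneckerMap_apply, add_mul, mul_add, smul_mul_smul_comm, hexp, hexp', hexp₀,
    mul_comm (Complex.exp (-(Complex.I * (φ/2)))) (Complex.exp (Complex.I * (φ/2))), pow_succ,
    mul_neg, neg_mul, mul_one, one_smul, neg_smul]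
  abel

end
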